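/- Let A be a unital commutative ℝ-algebra, (b_a)_{a∈A} a family of positive reals, and L : A → ℝ linear with L(1)=1. The following are equivalent: (i) for every a ∈ A there is a positive Radon measure μ_a on [−b_a, b_a] with L(aⁿ) = ∫ xⁿ dμ_a(x) for all n; (ii) L is positive semidefinite and sup_{n, L(a^{2n})≠0} L(a^{2n+2})/L(a^{2n}) ≤ b_a² for all a; (iii) there is a unique positive Radon measure μ on K = {α ∈ X(A) : |α(a)| ≤ b_a for all a} with L(a) = ∫_K α(a) dμ(α) for all a ∈ A. -/

import Mathlib

open MeasureTheory

variable {A : Type*} [CommRing A] [Algebra ℝ A]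

/-- The set of ratios `L(a^{2n+2})/L(a^{2n})` over `n` with `L(a^{2n}) ≠ 0`. -/
def ratioSet (L : A →ₗ[ℝ] ℝ) (a : A) : Set ℝ :=
  {r | ∃ n : ℕ, L (a ^ (2 * n)) ≠ 0 ∧ r = L (a ^ (2 * n + 2)) / L (a ^ (2 * n))}

/-- `v_L(a) = sqrt( sup_{n, L(a^{2n}) ≠ 0} L(a^{2n+2})/L(a^{2n}) )`. -/
noncomputable def vL (L : A →ₗ[ℝ] ℝ) (a : A) : ℝ :=
  Real.sqrt (sSup (ratioSet L a))

/-- The set of (underlying functions of) ℝ-algebra homomorphisms `A → ℝ`,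
as a subset of `A → ℝ` with the topology of pointwise convergence. -/
def charSet (A : Type*) [CommRing A] [Algebra ℝ A] : Set (A → ℝ) :=
  {φ | ∃ ψ : A →ₐ[ℝ] ℝ, ⇑ψ = φ}

lemma psd_cs (l : A →ₗ[ℝ] ℝ) (hp : ∀ x, 0 ≤ l (x ^ 2)) (x y : A) :
    (l (x * y)) ^ 2 ≤ l (x ^ 2) * l (y ^ 2) := by
  have h : ∀ t : ℝ, 0 ≤ l (x ^ 2) * (t * t) + (2 * l (x * y)) * t + l (y ^ 2) := by
    intro t
    have h := hp (t • x + y)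
    have e : (t • x + y) ^ 2 = (t * t) • x ^ 2 + (2 * t) • (x * y) + y ^ 2 := by
      simp only [Algebra.smul_def, map_mul, map_ofNat]; ring
    rw [e, map_add, map_add, map_smul, map_smul, smul_eq_mul, smul_eq_mul] at h
    linarith
  have := discrim_le_zero h
  unfold discrim at this
  nlinarith

/-- growth bound implies boundedness of multiplication -/
lemma psd_bound (l : A →ₗ[ℝ] ℝ) (hp : ∀ x, 0 ≤ l (x ^ 2)) (a : A) (β C : ℝ) (hβ : 0 < β)
    (hg : ∀ n : ℕ, l (a ^ (2 * n)) ≤ C * β ^ (2 * n)) (x : A) :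
    |l (a * x ^ 2)| ≤ β * l (x ^ 2) := by
  rcases (hp x).eq_or_lt with h0 | h0
  · have h := psd_cs l hp (a * x) x
    rw [← h0, mul_zero] at h
    have e : a * x * x = a * x ^ 2 := by ring
    rw [e] at h
    have : l (a * x ^ 2) = 0 := by nlinarith
    simp [this, ← h0]
  set s := l (x ^ 2) with hs
  set r : ℕ → ℝ := fun k => l (a ^ (2 ^ k) * x ^ 2) / s with hr
  have hstep : ∀ k, r k ^ 2 ≤ r (k + 1) := by
    intro k
    have h := psd_cs l hp (a ^ (2 ^ k) * x) x
    have e1 : a ^ (2 ^ k) * x * x = a ^ (2 ^ k) * x ^ 2 := by ring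
    have e2 : (a ^ (2 ^ k) * x) ^ 2 = a ^ (2 ^ (k + 1)) * x ^ 2 := by
      rw [mul_pow, ← pow_mul, pow_succ 2 k]
    rw [e1, e2] at h
    simp only [hr]
    rw [div_pow, div_le_div_iff₀ (by positivity) h0]
    nlinarith
  have hpow : ∀ k, |r 0| ^ (2 ^ k) ≤ |r k| := by
    intro k
    induction k with
    | zero => simp
    | succ k ih =>
      rw [pow_succ, pow_mul]
      calc _ ≤ |r k| ^ 2 := by gcongr
        _ = r k ^ 2 := sq_abs _
        _ ≤ r (k + 1) := hstep k
        _ ≤ _ := le_abs_self _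
  have hub : ∀ k, r k ^ 2 ≤ (C * l (x ^ 4) / s ^ 2) * (β ^ 2) ^ (2 ^ k) := by
    intro k
    have h := psd_cs l hp (a ^ (2 ^ k)) (x ^ 2)
    rw [← pow_mul, ← pow_mul, mul_comm (2 ^ k) 2] at h
    have h2 := hg (2 ^ k)
    have h4 : 0 ≤ l (x ^ (2 * 2)) := by rw [pow_mul]; exact hp _
    have h5 := mul_le_mul_of_nonneg_right h2 h4
    simp only [hr]
    rw [div_pow, div_mul_eq_mul_div]
    gcongr
    rw [← pow_mul]
    refine (h.trans h5).trans (le_of_eq ?_)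
    norm_num
    ring
  have hq : ∀ k : ℕ, ((r 0 / β) ^ 2) ^ (2 ^ k) ≤ C * l (x ^ 4) / s ^ 2 := by
    intro k
    rw [div_pow, div_pow, div_le_iff₀ (by positivity)]
    refine le_trans ?_ (hub k)
    rw [← sq_abs (r 0), ← sq_abs (r k), ← pow_mul, mul_comm, pow_mul]
    have := hpow k
    gcongr
  have hle : (r 0 / β) ^ 2 ≤ 1 := by
    by_contra! hlt
    obtain ⟨n, hn⟩ := pow_unbounded_of_one_lt (C * l (x ^ 4) / s ^ 2) hlt
    have : ((r 0 / β) ^ 2) ^ n ≤ ((r 0 / β) ^ 2) ^ (2 ^ n) :=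
      pow_le_pow_right₀ hlt.le (Nat.lt_two_pow_self).le
    linarith [hq n]
  have h3 : |r 0 / β| ≤ 1 := by
    rwa [sq_le_one_iff_abs_le_one] at hle
  rw [abs_div, abs_of_pos hβ, div_le_one hβ] at h3
  simp only [hr, pow_zero, pow_one] at h3
  rw [abs_div, abs_of_pos h0, div_le_iff₀ h0] at h3
  exact h3

/-- the state space -/
def StS (b : A → ℝ) : Set (A → ℝ) :=
  {f | ∃ l : A →ₗ[ℝ] ℝ, ⇑l = f ∧ l 1 = 1 ∧ ∀ a x, |l (a * x ^ 2)| ≤ b a * l (x ^ 2)}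

lemma bdd_psd {b : A → ℝ} (hb : ∀ a, 0 < b a) {l : A →ₗ[ℝ] ℝ}
    (h : ∀ a x, |l (a * x ^ 2)| ≤ b a * l (x ^ 2)) (x : A) : 0 ≤ l (x ^ 2) := by
  have h1 := (abs_nonneg _).trans (h 1 x)
  exact nonneg_of_mul_nonneg_right h1 (hb 1)

lemma bdd_sq {b : A → ℝ} (hb : ∀ a, 0 < b a) {l : A →ₗ[ℝ] ℝ}
    (h : ∀ a x, |l (a * x ^ 2)| ≤ b a * l (x ^ 2)) (a x : A) :
    l (a ^ 2 * x ^ 2) ≤ b a ^ 2 * l (x ^ 2) := by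
  set β := algebraMap ℝ A (b a) with hβ
  have h1 := (abs_le.1 (h a ((β - a) * x))).1
  have h2 := (abs_le.1 (h a ((β + a) * x))).2
  have key : ∀ y, l (β * y) = b a * l y := by
    intro y; rw [hβ, ← Algebra.smul_def, map_smul, smul_eq_mul]
  have e1 : l (β * ((β - a) * x) ^ 2 + a * ((β - a) * x) ^ 2)
      + l (β * ((β + a) * x) ^ 2 - a * ((β + a) * x) ^ 2)
      = 2 * (b a * (b a ^ 2 * l (x ^ 2) - l (a ^ 2 * x ^ 2))) := by
    rw [← map_add]
    have : β * ((β - a) * x) ^ 2 + a * ((β - a) * x) ^ 2 +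
      (β * ((β + a) * x) ^ 2 - a * ((β + a) * x) ^ 2) =
      β * (β * (β * x ^ 2)) + β * (β * (β * x ^ 2)) - β * (a ^ 2 * x ^ 2) - β * (a ^ 2 * x ^ 2) := by
      ring
    rw [this]
    simp only [map_add, map_sub, key]
    ring
  rw [map_add, map_sub, key, key] at e1
  have h3 : 0 ≤ b a * (b a ^ 2 * l (x ^ 2) - l (a ^ 2 * x ^ 2)) := by linarith
  have := nonneg_of_mul_nonneg_right h3 (hb a)
  linarith

lemma bdd_growth {b : A → ℝ} (hb : ∀ a, 0 < b a) {l : A →ₗ[ℝ] ℝ}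
    (h : ∀ a x, |l (a * x ^ 2)| ≤ b a * l (x ^ 2)) (a : A) (n : ℕ) :
    l (a ^ (2 * n)) ≤ l 1 * b a ^ (2 * n) := by
  induction n with
  | zero => simp
  | succ n ih =>
    have h1 := bdd_sq hb h a (a ^ n)
    rw [← mul_pow, ← pow_succ', ← pow_mul, ← pow_mul, mul_comm _ 2, mul_comm _ 2] at h1
    have : b a ^ 2 * l (a ^ (2 * n)) ≤ b a ^ 2 * (l 1 * b a ^ (2 * n)) := by
      gcongr
    calc _ ≤ _ := h1
      _ ≤ _ := this
      _ = _ := by ring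

lemma twist_mem {b : A → ℝ} (hb : ∀ a, 0 < b a) {l : A →ₗ[ℝ] ℝ}
    (h : ∀ a x, |l (a * x ^ 2)| ≤ b a * l (x ^ 2)) (d : A) (hd : 0 < l d)
    (hd0 : ∀ x, 0 ≤ l (d * x ^ 2)) (M : ℝ) (hM : 0 ≤ M)
    (hdM : ∀ x, l (d * x ^ 2) ≤ M * l (x ^ 2)) :
    (fun x => (l d)⁻¹ * l (d * x)) ∈ StS b := by
  have hi : 0 < (l d)⁻¹ := inv_pos.2 hd
  refine ⟨(l d)⁻¹ • (l ∘ₗ LinearMap.mulLeft ℝ d), by ext; simp, by simp [hd.ne'], ?_⟩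
  intro a x
  refine psd_bound _ ?_ a (b a) ((l d)⁻¹ * (M * l 1)) (hb a) ?_ x
  · intro x
    simpa using mul_nonneg hi.le (hd0 x)
  · intro n
    simp only [LinearMap.smul_apply, LinearMap.comp_apply, LinearMap.mulLeft_apply, smul_eq_mul]
    rw [mul_assoc]
    refine mul_le_mul_of_nonneg_left ?_ hi.le
    have h1 := hdM (a ^ n)
    rw [← pow_mul, mul_comm n 2] at h1
    refine h1.trans ?_
    rw [mul_assoc]
    exact mul_le_mul_of_nonneg_left (bdd_growth hb h a n) hM

lemma stS_subset {b : A → ℝ} {f : A → ℝ} (hf : f ∈ StS b) (a : A) : |f a| ≤ b a := by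
  obtain ⟨l, rfl, h1, h⟩ := hf
  simpa [h1] using h a 1

lemma extreme_char {b : A → ℝ} (hb : ∀ a, 0 < b a) {f : A → ℝ}
    (hf : f ∈ (StS b).extremePoints ℝ) : f ∈ charSet A := by
  obtain ⟨hf, hext⟩ := hf
  have hfS := hf
  obtain ⟨l, rfl, h1, h⟩ := hf
  have hp := bdd_psd hb h
  have hmul : ∀ a x, l (a * x) = l a * l x := by
    intro a x
    have hba := hb a
    set s : ℝ := (4 * b a)⁻¹ with hs
    have hs0 : 0 < s := by positivity
    have hsb : s * b a = 1 / 4 := by rw [hs]; field_simp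
    have habs := abs_le.1 (stS_subset hfS a)
    have ev : ∀ (t : ℝ) (y : A), l (((1 / 2 : ℝ) • 1 + t • a) * y) = 1 / 2 * l y + t * l (a * y) := by
      intro t y
      rw [add_mul, smul_mul_assoc, smul_mul_assoc, one_mul, map_add, map_smul, map_smul]
      simp
    have mem : ∀ t : ℝ, |t| = s →
        (fun x => (l ((1 / 2 : ℝ) • 1 + t • a))⁻¹ * l (((1 / 2 : ℝ) • 1 + t • a) * x)) ∈ StS b ∧
        0 < l ((1 / 2 : ℝ) • 1 + t • a) := by
      intro t ht
      have hb2 : ∀ x, |t * l (a * x ^ 2)| ≤ 1 / 4 * l (x ^ 2) := by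
        intro x
        rw [abs_mul, ht, ← hsb, mul_assoc]
        exact mul_le_mul_of_nonneg_left (h a x) hs0.le
      have hpos : 0 < l ((1 / 2 : ℝ) • 1 + t • a) := by
        have := ev t 1
        rw [mul_one] at this
        rw [this]
        have h3 := abs_le.1 (hb2 1)
        simp only [one_pow, mul_one, h1] at h3 ⊢
        linarith
      refine ⟨twist_mem hb h _ hpos ?_ 1 zero_le_one ?_, hpos⟩
      · intro x
        rw [ev]
        have h3 := abs_le.1 (hb2 x)
        have := hp x
        linarith
      · intro x
        rw [ev]
        have h3 := abs_le.1 (hb2 x)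
        have := hp x
        linarith
    obtain ⟨m1, p1⟩ := mem s (abs_of_pos hs0)
    obtain ⟨m2, p2⟩ := mem (-s) (by rw [abs_neg, abs_of_pos hs0])
    have ev1 : ∀ t : ℝ, l ((1 / 2 : ℝ) • 1 + t • a) = 1 / 2 + t * l a := by
      intro t
      simp [h1]
    have hseg := hext m1 m2 ⟨_, _, p1, p2, by rw [ev1, ev1]; ring, by
      ext y
      simp only [Pi.add_apply, Pi.smul_apply, smul_eq_mul]
      rw [mul_inv_cancel_left₀ p1.ne', mul_inv_cancel_left₀ p2.ne', ev, ev]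
      ring⟩
    have h5 := congrFun hseg x
    rw [inv_mul_eq_iff_eq_mul₀ p1.ne', ev, ev1] at h5
    have : s * (l (a * x) - l a * l x) = 0 := by linarith
    have := (mul_eq_zero.1 this).resolve_left hs0.ne'
    linarith
  exact ⟨AlgHom.ofLinearMap l h1 hmul, rfl⟩

lemma stS_eq (b : A → ℝ) : StS b =
    {f | (∀ x y, f (x + y) = f x + f y) ∧ (∀ (c : ℝ) x, f (c • x) = c * f x) ∧ f 1 = 1 ∧
      ∀ a x, |f (a * x ^ 2)| ≤ b a * f (x ^ 2)} := by
  ext f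
  constructor
  · rintro ⟨l, rfl, h1, h⟩
    exact ⟨by simp, by simp, h1, h⟩
  · rintro ⟨ha, hs, h1, h⟩
    exact ⟨{ toFun := f, map_add' := ha, map_smul' := hs }, rfl, h1, h⟩

lemma stS_closed (b : A → ℝ) : IsClosed (StS b) := by
  rw [stS_eq]
  simp only [Set.ofPred_and, Set.ofPred_forall]
  refine IsClosed.inter ?_ (IsClosed.inter ?_ (IsClosed.inter ?_ ?_))
  · exact isClosed_iInter fun x => isClosed_iInter fun y => isClosed_eq (by fun_prop) (by fun_prop)
  · exact isClosed_iInter fun x => isClosed_iInter fun y => isClosed_eq (by fun_prop) (by fun_prop)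
  · exact isClosed_eq (by fun_prop) (by fun_prop)
  · exact isClosed_iInter fun x => isClosed_iInter fun y => isClosed_le (by fun_prop) (by fun_prop)

lemma box_compact (b : A → ℝ) : IsCompact (Set.pi Set.univ fun a => Set.Icc (-(b a)) (b a)) :=
  isCompact_univ_pi fun _ => isCompact_Icc

lemma stS_compact (b : A → ℝ) : IsCompact (StS b) :=
  (box_compact b).of_isClosed_subset (stS_closed b) fun _ hf a _ => abs_le.1 (stS_subset hf a)

lemma stS_convex (b : A → ℝ) : Convex ℝ (StS b) := by
  rintro f ⟨l, rfl, h1, h⟩ g ⟨m, rfl, k1, k⟩ s t hs ht hst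
  refine ⟨s • l + t • m, by ext; simp, by simp [h1, k1, hst], ?_⟩
  intro a x
  simp only [LinearMap.add_apply, LinearMap.smul_apply, smul_eq_mul]
  refine (abs_add_le _ _).trans ?_
  rw [abs_mul, abs_mul, abs_of_nonneg hs, abs_of_nonneg ht]
  have := mul_le_mul_of_nonneg_left (h a x) hs
  have := mul_le_mul_of_nonneg_left (k a x) ht
  linarith

/-- the compact set of bounded characters -/
abbrev KS (b : A → ℝ) : Set (A → ℝ) := {φ ∈ charSet A | ∀ a : A, |φ a| ≤ b a}

lemma charSet_closed : IsClosed (charSet A) := by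
  have : charSet A = {f | (∀ x y, f (x + y) = f x + f y) ∧ (∀ (c : ℝ) x, f (c • x) = c * f x) ∧
      f 1 = 1 ∧ ∀ x y, f (x * y) = f x * f y} := by
    ext f
    constructor
    · rintro ⟨l, rfl⟩
      exact ⟨by simp, by simp, by simp, by simp⟩
    · rintro ⟨ha, hs, h1, h⟩
      exact ⟨AlgHom.ofLinearMap { toFun := f, map_add' := ha, map_smul' := hs } h1 h, rfl⟩
  rw [this]
  simp only [Set.ofPred_and, Set.ofPred_forall]
  refine IsClosed.inter ?_ (IsClosed.inter ?_ (IsClosed.inter ?_ ?_))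
  · exact isClosed_iInter fun x => isClosed_iInter fun y => isClosed_eq (by fun_prop) (by fun_prop)
  · exact isClosed_iInter fun x => isClosed_iInter fun y => isClosed_eq (by fun_prop) (by fun_prop)
  · exact isClosed_eq (by fun_prop) (by fun_prop)
  · exact isClosed_iInter fun x => isClosed_iInter fun y => isClosed_eq (by fun_prop) (by fun_prop)

lemma KS_compact (b : A → ℝ) : IsCompact (KS b) := by
  refine (box_compact b).of_isClosed_subset ?_ fun _ hf a _ => abs_le.1 (hf.2 a)
  simp only [KS, Set.ofPred_and, Set.ofPred_forall]
  refine charSet_closed.inter ?_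
  exact isClosed_iInter fun x => isClosed_le (by fun_prop) (by fun_prop)

lemma nonneg_of_KS {b : A → ℝ} (hb : ∀ a, 0 < b a) {f : A → ℝ} (hf : f ∈ StS b) (a : A)
    (ha : ∀ φ ∈ KS b, 0 ≤ φ a) : 0 ≤ f a := by
  rw [← closure_convexHull_extremePoints (stS_compact b) (stS_convex b)] at hf
  have hcl : IsClosed {f : A → ℝ | 0 ≤ f a} := isClosed_le (by fun_prop) (by fun_prop)
  have hcv : Convex ℝ {f : A → ℝ | 0 ≤ f a} := by
    intro f hf g hg s t hs ht _
    simp only [Set.mem_ofPred_eq] at hf hg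
    simp only [Set.mem_ofPred_eq, Pi.add_apply, Pi.smul_apply, smul_eq_mul]
    positivity
  refine closure_minimal (convexHull_min ?_ hcv) hcl hf
  intro g hg
  exact ha g ⟨extreme_char hb hg, stS_subset hg.1⟩

lemma rmk {X : Type*} [TopologicalSpace X] [CompactSpace X] [T2Space X] [MeasurableSpace X]
    [BorelSpace X] (g : C(X, ℝ) →ₗ[ℝ] ℝ) (hg : ∀ f, (∀ x, 0 ≤ f x) → 0 ≤ g f) :
    ∃ μ : Measure X, IsFiniteMeasure μ ∧ ∀ f : C(X, ℝ), g f = ∫ x, f x ∂μ := by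
  let l0 : CompactlySupportedContinuousMap X ℝ →ₗ[ℝ] ℝ :=
    { toFun := fun f => g f.toContinuousMap
      map_add' := fun x y => by rw [← map_add]; rfl
      map_smul' := fun c y => by rw [RingHom.id_apply, ← map_smul]; rfl }
  let Λ := PositiveLinearMap.mk₀ l0 (fun f hf => hg _ (fun x => CompactlySupportedContinuousMap.le_def.1 hf x))
  refine ⟨RealRMK.rieszMeasure Λ, inferInstance, fun f => ?_⟩
  exact (RealRMK.integral_rieszMeasure Λ (CompactlySupportedContinuousMap.continuousMapEquiv f)).symm

/-- Gelfand transform -/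
noncomputable def gel (b : A → ℝ) : A →ₗ[ℝ] C(KS b, ℝ) where
  toFun a := ⟨fun φ => φ.1 a, (continuous_apply a).comp continuous_subtype_val⟩
  map_add' x y := by
    ext ⟨φ, ⟨⟨ψ, rfl⟩, h⟩⟩
    simp
  map_smul' c y := by
    ext ⟨φ, ⟨⟨ψ, rfl⟩, h⟩⟩
    simp

lemma exists_rep {b : A → ℝ} (hb : ∀ a, 0 < b a) (L : A →ₗ[ℝ] ℝ) (hL : ⇑L ∈ StS b) :
    ∃ μ : Measure (KS b), IsFiniteMeasure μ ∧ ∀ a : A, L a = ∫ φ, (φ : A → ℝ) a ∂μ := by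
  haveI : CompactSpace (KS b) := isCompact_iff_compactSpace.1 (KS_compact b)
  obtain ⟨r, hr⟩ := (gel b).rangeRestrict.exists_rightInverse_of_surjective
    (LinearMap.range_rangeRestrict _)
  have hr' : ∀ y : (gel b).range, gel b (r y) = y := fun y =>
    congrArg Subtype.val (LinearMap.congr_fun hr y)
  have hpos : ∀ a, (∀ φ, 0 ≤ gel b a φ) → 0 ≤ L a := fun a ha =>
    nonneg_of_KS hb hL a fun φ hφ => ha ⟨φ, hφ⟩
  have hker : ∀ a c, gel b a = gel b c → L a = L c := by
    intro a c hac
    have h1 := hpos (a - c) (by intro φ; rw [map_sub, hac, sub_self]; simp)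
    have h2 := hpos (c - a) (by intro φ; rw [map_sub, hac, sub_self]; simp)
    rw [map_sub] at h1 h2
    linarith
  let cone : PointedCone ℝ C(KS b, ℝ) :=
    { carrier := {f | ∀ x, 0 ≤ f x}
      add_mem' := fun {f g} hf hg x => add_nonneg (hf x) (hg x)
      zero_mem' := fun x => le_rfl
      smul_mem' := fun c f hf x => mul_nonneg c.2 (hf x) }
  obtain ⟨g, hg1, hg2⟩ := riesz_extension cone ⟨(gel b).range, L ∘ₗ r⟩
    (by
      intro x hx
      refine hpos _ ?_
      rw [hr']
      exact hx)
    (by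
      intro y
      refine ⟨⟨gel b (algebraMap ℝ A ‖y‖), LinearMap.mem_range_self _ _⟩, ?_⟩
      rintro ⟨φ, ⟨⟨ψ, rfl⟩, h⟩⟩
      have := (abs_le.1 (y.norm_coe_le_norm ⟨ψ, ⟨⟨ψ, rfl⟩, h⟩⟩)).1
      have e : gel b (algebraMap ℝ A ‖y‖) ⟨ψ, ⟨⟨ψ, rfl⟩, h⟩⟩ = ‖y‖ := by
        change ψ (algebraMap ℝ A ‖y‖) = _
        rw [AlgHom.commutes]; rfl
      rw [ContinuousMap.add_apply, e]
      linarith)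
  obtain ⟨μ, hμ, hμg⟩ := @rmk (KS b) _ _ _ (borel _) (@BorelSpace.mk _ _ (borel _) rfl) g hg2
  have hm : (inferInstance : MeasurableSpace (KS b)) ≤ borel (KS b) := by
    have : @Measurable _ _ (borel (KS b)) _ (Subtype.val : KS b → A → ℝ) := by
      letI : MeasurableSpace (KS b) := borel _
      haveI : BorelSpace (KS b) := ⟨rfl⟩
      refine measurable_pi_iff.2 fun a => Continuous.measurable ((continuous_apply a).comp continuous_subtype_val)
    exact this.comap_le
  refine ⟨μ.trim hm, isFiniteMeasure_trim hm, fun a => ?_⟩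
  rw [← integral_trim hm]
  · rw [← hker _ _ (hr' ⟨gel b a, LinearMap.mem_range_self _ _⟩)]
    refine Eq.trans ?_ (hμg (gel b a))
    exact (hg1 ⟨gel b a, LinearMap.mem_range_self _ _⟩).symm
  · apply Measurable.stronglyMeasurable
    exact (measurable_pi_apply a).comp measurable_subtype_coe

lemma char_pow {b : A → ℝ} (φ : KS b) (a : A) (n : ℕ) : φ.1 (a ^ n) = φ.1 a ^ n := by
  obtain ⟨φ, ⟨⟨ψ, rfl⟩, h⟩⟩ := φ
  simp

lemma meas_eval (b : A → ℝ) (a : A) : Measurable (fun φ : KS b => φ.1 a) :=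
  (measurable_pi_apply a).comp measurable_subtype_coe

lemma hasSum_exp {b : A → ℝ} (L : A →ₗ[ℝ] ℝ) (μ : Measure (KS b)) [IsFiniteMeasure μ]
    (h : ∀ a : A, L a = ∫ φ, (φ : A → ℝ) a ∂μ) (c : A) :
    HasSum (fun n : ℕ => Complex.I ^ n / (n.factorial : ℂ) * (L (c ^ n) : ℂ))
      (∫ φ, Complex.exp ((φ.1 c : ℝ) * Complex.I) ∂μ) := by
  have key : ∀ n : ℕ, Complex.I ^ n / (n.factorial : ℂ) * (L (c ^ n) : ℂ) =
      ∫ φ : KS b, ((φ.1 c : ℂ) * Complex.I) ^ n / (n.factorial : ℂ) ∂μ := by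
    intro n
    rw [h, ← integral_complex_ofReal, ← integral_const_mul]
    congr 1
    ext φ
    rw [char_pow]
    push_cast
    ring
  simp only [key]
  refine hasSum_integral_of_dominated_convergence (fun n _ => |b c| ^ n / (n.factorial : ℝ))
    ?_ ?_ ?_ ?_ ?_
  · intro n
    refine Measurable.aestronglyMeasurable ?_
    have := Complex.measurable_ofReal.comp (meas_eval b c)
    exact ((this.mul_const _).pow_const n).div_const _
  · intro n
    refine Filter.Eventually.of_forall fun φ => ?_
    rw [norm_div, norm_pow, norm_mul, Complex.norm_I, mul_one, Complex.norm_real, Complex.norm_natCast]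
    have : |φ.1 c| ≤ |b c| := (φ.2.2 c).trans (le_abs_self _)
    rw [Real.norm_eq_abs]
    gcongr
  · exact Filter.Eventually.of_forall fun φ => Real.summable_pow_div_factorial _
  · exact integrable_const _
  · refine Filter.Eventually.of_forall fun φ => ?_
    rw [Complex.exp_eq_exp_ℂ]
    exact NormedSpace.expSeries_div_hasSum_exp _

lemma rep_unique {b : A → ℝ} (L : A →ₗ[ℝ] ℝ) (μ ν : Measure (KS b)) [IsFiniteMeasure μ]
    [IsFiniteMeasure ν] (hμ : ∀ a : A, L a = ∫ φ, (φ : A → ℝ) a ∂μ)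
    (hν : ∀ a : A, L a = ∫ φ, (φ : A → ℝ) a ∂ν) : μ = ν := by
  classical
  have hval : Measurable (Subtype.val : KS b → A → ℝ) := measurable_subtype_coe
  have hmap : μ.map Subtype.val = ν.map Subtype.val := by
    refine IsProjectiveLimit.unique
      (P := fun I : Finset A => (ν.map Subtype.val).map I.restrict) ?_ (fun I => rfl)
    intro I
    have hres : Measurable (I.restrict : (A → ℝ) → I → ℝ) := Finset.measurable_restrict I
    have aux : ∀ (ρ : Measure (KS b)) [IsFiniteMeasure ρ], ∀ T : StrongDual ℝ (I → ℝ),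
        charFunDual ((ρ.map Subtype.val).map I.restrict) T =
        ∫ φ, Complex.exp ((φ.1 (∑ i : I, T (Pi.single i 1) • (i : A)) : ℝ) * Complex.I) ∂ρ := by
      intro ρ _ T
      rw [charFunDual_apply, Measure.map_map hres hval, integral_map (hres.comp hval).aemeasurable]
      · congr 1
        ext φ
        congr 3
        obtain ⟨φ, ⟨⟨ψ, rfl⟩, h⟩⟩ := φ
        have : (I.restrict (⇑ψ) : I → ℝ) = ∑ i : I, ψ i • (Pi.single i 1 : I → ℝ) := by
          ext j
          simp [Finset.sum_apply, Pi.single_apply]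
        simp only [Function.comp_apply]
        rw [this]
        simp only [map_sum, map_smul, smul_eq_mul]
        exact Finset.sum_congr rfl fun i _ => mul_comm _ _
      · refine Measurable.aestronglyMeasurable ?_
        have := Complex.measurable_ofReal.comp T.continuous.measurable
        exact Complex.measurable_exp.comp (this.mul_const _)
    refine Measure.ext_of_charFunDual (funext fun T => ?_)
    rw [aux μ, aux ν]
    exact (hasSum_exp L μ hμ _).unique (hasSum_exp L ν hν _)
  ext s hs
  obtain ⟨t, ht, rfl⟩ := hs
  rw [← Measure.map_apply hval ht, ← Measure.map_apply hval ht, hmap]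

lemma L_mem {b : A → ℝ} (hb : ∀ a, 0 < b a) (L : A →ₗ[ℝ] ℝ) (h1 : L 1 = 1)
    (hp : ∀ x : A, 0 ≤ L (x ^ 2)) (hr : ∀ a : A, ∀ r ∈ ratioSet L a, r ≤ (b a) ^ 2) :
    ⇑L ∈ StS b := by
  refine ⟨L, rfl, h1, fun a x => psd_bound L hp a (b a) 1 (hb a) ?_ x⟩
  intro n
  induction n with
  | zero => simp [h1]
  | succ n ih =>
    have h0 : 0 ≤ L (a ^ (2 * n)) := by rw [mul_comm, pow_mul]; exact hp _
    rcases h0.eq_or_lt with h0 | h0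
    · have h := psd_cs L hp (a ^ n) (a ^ (n + 2))
      rw [← pow_mul, mul_comm n 2, ← h0, zero_mul, ← pow_add] at h
      have e : n + (n + 2) = 2 * (n + 1) := by ring
      rw [e] at h
      have : L (a ^ (2 * (n + 1))) = 0 := by nlinarith
      rw [this]
      have := hb a
      positivity
    · have h := hr a _ ⟨n, h0.ne', rfl⟩
      rw [div_le_iff₀ h0] at h
      rw [show 2 * (n + 1) = 2 * n + 2 by ring]
      calc _ ≤ _ := h
        _ ≤ b a ^ 2 * (1 * b a ^ (2 * n)) := by gcongr
        _ = _ := by ring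

lemma i_to_ii {b : A → ℝ} (L : A →ₗ[ℝ] ℝ)
    (h : ∀ a : A, ∃ μ : Measure ℝ, IsFiniteMeasure μ ∧ μ (Set.Icc (-(b a)) (b a))ᶜ = 0 ∧
        ∀ n : ℕ, L (a ^ n) = ∫ x, x ^ n ∂μ) :
    (∀ x : A, 0 ≤ L (x ^ 2)) ∧ ∀ a : A, ∀ r ∈ ratioSet L a, r ≤ (b a) ^ 2 := by
  have hp : ∀ x : A, 0 ≤ L (x ^ 2) := by
    intro a
    obtain ⟨μ, _, _, hm⟩ := h a
    rw [hm]
    exact integral_nonneg fun x => by positivity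
  refine ⟨hp, ?_⟩
  rintro a r ⟨n, hn, rfl⟩
  have h0 : 0 ≤ L (a ^ (2 * n)) := by rw [mul_comm, pow_mul]; exact hp _
  rw [div_le_iff₀ (lt_of_le_of_ne h0 hn.symm)]
  obtain ⟨μ, _, hz, hm⟩ := h a
  have hae : ∀ᵐ x ∂μ, |x| ≤ b a := by
    rw [ae_iff]
    refine measure_mono_null ?_ hz
    intro x hx hx'
    exact hx (abs_le.2 hx')
  have hint : ∀ k : ℕ, Integrable (fun x : ℝ => x ^ k) μ := by
    intro k
    refine Integrable.of_bound (by fun_prop) ((b a) ^ k) ?_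
    filter_upwards [hae] with x hx
    rw [norm_pow, Real.norm_eq_abs]
    gcongr
  rw [hm, hm, ← integral_const_mul]
  refine integral_mono_ae (hint _) ((hint _).const_mul _) ?_
  filter_upwards [hae] with x hx
  have h2 : x ^ 2 ≤ b a ^ 2 := by rw [← sq_abs x]; gcongr
  have h3 : 0 ≤ x ^ (2 * n) := by rw [pow_mul]; positivity
  change x ^ (2 * n + 2) ≤ b a ^ 2 * x ^ (2 * n)
  rw [pow_add]
  nlinarith

lemma iii_to_i {b : A → ℝ} (L : A →ₗ[ℝ] ℝ) (μ : Measure (KS b)) [IsFiniteMeasure μ]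
    (hμ : ∀ a : A, L a = ∫ φ, (φ : A → ℝ) a ∂μ) (a : A) :
    ∃ μ : Measure ℝ, IsFiniteMeasure μ ∧ μ (Set.Icc (-(b a)) (b a))ᶜ = 0 ∧
        ∀ n : ℕ, L (a ^ n) = ∫ x, x ^ n ∂μ := by
  refine ⟨μ.map (fun φ => φ.1 a), inferInstance, ?_, fun n => ?_⟩
  · rw [Measure.map_apply (meas_eval b a) measurableSet_Icc.compl]
    convert measure_empty (μ := μ)
    ext φ
    simpa using abs_le.1 (φ.2.2 a)
  · rw [integral_map (meas_eval b a).aemeasurable (by fun_prop), hμ]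
    simp only [char_pow]

theorem stmt11 (hX : Nonempty (A →ₐ[ℝ] ℝ)) (b : A → ℝ) (hb : ∀ a : A, 0 < b a)
    (L : A →ₗ[ℝ] ℝ) (h1 : L 1 = 1) :
    ((∀ a : A, ∃ μ : Measure ℝ, IsFiniteMeasure μ ∧ μ (Set.Icc (-(b a)) (b a))ᶜ = 0 ∧
        ∀ n : ℕ, L (a ^ n) = ∫ x, x ^ n ∂μ) ↔
      ((∀ x : A, 0 ≤ L (x ^ 2)) ∧ ∀ a : A, ∀ r ∈ ratioSet L a, r ≤ (b a) ^ 2)) ∧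
    (((∀ x : A, 0 ≤ L (x ^ 2)) ∧ ∀ a : A, ∀ r ∈ ratioSet L a, r ≤ (b a) ^ 2) ↔
      (∃! μ : Measure ({φ ∈ charSet A | ∀ a : A, |φ a| ≤ b a} : Set (A → ℝ)),
        IsFiniteMeasure μ ∧ ∀ a : A, L a = ∫ φ, (φ : A → ℝ) a ∂μ)) := by
  have h23 : ((∀ x : A, 0 ≤ L (x ^ 2)) ∧ ∀ a : A, ∀ r ∈ ratioSet L a, r ≤ (b a) ^ 2) →
      (∃! μ : Measure (KS b), IsFiniteMeasure μ ∧ ∀ a : A, L a = ∫ φ, (φ : A → ℝ) a ∂μ) := by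
    rintro ⟨hp, hr⟩
    obtain ⟨μ, hf, hμ⟩ := exists_rep hb L (L_mem hb L h1 hp hr)
    refine ⟨μ, ⟨hf, hμ⟩, ?_⟩
    rintro ν ⟨hfν, hν⟩
    exact rep_unique L ν μ hν hμ
  have h31 : (∃! μ : Measure (KS b), IsFiniteMeasure μ ∧ ∀ a : A, L a = ∫ φ, (φ : A → ℝ) a ∂μ) →
      ∀ a : A, ∃ μ : Measure ℝ, IsFiniteMeasure μ ∧ μ (Set.Icc (-(b a)) (b a))ᶜ = 0 ∧
        ∀ n : ℕ, L (a ^ n) = ∫ x, x ^ n ∂μ := by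
    rintro ⟨μ, ⟨hf, hμ⟩, -⟩
    exact iii_to_i L μ hμ
  exact ⟨⟨i_to_ii L, fun h => h31 (h23 h)⟩, ⟨h23, fun h => i_to_ii L (h31 h)⟩⟩
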